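/- Let m ≥ 1, u ∈ ℝᵐ and t = |u|², and suppose α(t)φ(t) ≠ 0, α₁(t)·(α₁+α₃)(t) ≠ 0 and φ₁(t)·(φ₁+φ₃)(t) ≠ 0. Set ω₁ = α(t)/(α₁+α₃)(t) and ω₂ = [(φ₁+φ₃)(t)·(β₁(t)(α₁+α₃)(t) − α₂(t)β₂(t) − β₂(t)φ₂(t)) + φ₂(t)²·(β₁+β₃)(t)]/((α₁+α₃)(t)·(φ₁+φ₃)(t)). Then μ(ω₁,ω₂,u) is invertible and its inverse has (i,j) entry ((α₁+α₃)(t)/α(t))·δᵢⱼ − ψ_ω(t)·uⁱuʲ. -/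

import Mathlib

open Matrix

/-- The `m × m` real matrix with `(i,j)` entry `a·δᵢⱼ + b·uⁱuʲ`. -/
def mu {m : ℕ} (a b : ℝ) (u : Fin m → ℝ) : Matrix (Fin m) (Fin m) ℝ :=
  Matrix.of fun i j => a * (if i = j then (1 : ℝ) else 0) + b * u i * u j

/-- Matrices of the form `a·δᵢⱼ + b·uⁱuʲ` are closed under multiplication. -/
theorem mu_mul_mu {m : ℕ} (a b c d : ℝ) (u : Fin m → ℝ) :
    mu a b u * mu c d u = mu (a * c) (a * d + b * c + b * d * ∑ i, u i ^ 2) u := by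
  have h (x y : ℝ) : mu x y u = x • (1 : Matrix (Fin m) (Fin m) ℝ) + y • vecMulVec u u := by
    ext i j
    simp [mu, vecMulVec_apply, Matrix.one_apply, mul_assoc]
  have hu : u ⬝ᵥ u = ∑ i, u i ^ 2 := by simp [dotProduct, sq]
  have hv : vecMulVec u u * vecMulVec u u = (∑ i, u i ^ 2) • vecMulVec u u := by
    rw [vecMulVec_mul_vecMulVec, hu, vecMulVec_smul]
  simp only [h, add_mul, mul_add, smul_mul_assoc, mul_smul_comm, one_mul, mul_one, hv]
  module

theorem mu_one_zero {m : ℕ} (u : Fin m → ℝ) : mu 1 0 u = 1 := by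
  ext i j
  simp [mu, Matrix.one_apply]

theorem stmt6 (m : ℕ) (hm : 1 ≤ m) (α₁ α₂ α₃ β₁ β₂ β₃ : ℝ → ℝ)
    (u : Fin m → ℝ) (t : ℝ) (ht : t = ∑ i, u i ^ 2)
    (φ₁ φ₂ φ₃ A Φ : ℝ)
    (hφ₁ : φ₁ = α₁ t + t * β₁ t) (hφ₂ : φ₂ = α₂ t + t * β₂ t)
    (hφ₃ : φ₃ = α₃ t + t * β₃ t)
    (hA : A = α₁ t * (α₁ t + α₃ t) - α₂ t ^ 2)
    (hΦ : Φ = φ₁ * (φ₁ + φ₃) - φ₂ ^ 2)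
    (h1 : A * Φ ≠ 0) (h2 : α₁ t * (α₁ t + α₃ t) ≠ 0)
    (h3 : φ₁ * (φ₁ + φ₃) ≠ 0)
    (om₁ om₂ ψom : ℝ)
    (hom₁ : om₁ = A / (α₁ t + α₃ t))
    (hom₂ : om₂ = ((φ₁ + φ₃) * (β₁ t * (α₁ t + α₃ t) - α₂ t * β₂ t - β₂ t * φ₂)
        + φ₂ ^ 2 * (β₁ t + β₃ t)) / ((α₁ t + α₃ t) * (φ₁ + φ₃)))
    (hψom : ψom = ((α₁ t + α₃ t) * (β₁ t * (φ₁ + φ₃) - β₂ t * φ₂)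
        + α₂ t * (α₂ t * (β₁ t + β₃ t) - β₂ t * (α₁ t + α₃ t))) / (A * Φ)) :
    IsUnit (mu om₁ om₂ u) ∧
      ∀ i j, (mu om₁ om₂ u)⁻¹ i j =
        (α₁ t + α₃ t) / A * (if i = j then (1 : ℝ) else 0) - ψom * u i * u j := by
  have hAne : A ≠ 0 := left_ne_zero_of_mul h1
  have hΦne : Φ ≠ 0 := right_ne_zero_of_mul h1
  have hs : α₁ t + α₃ t ≠ 0 := right_ne_zero_of_mul h2
  have hF : φ₁ + φ₃ ≠ 0 := right_ne_zero_of_mul h3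
  have hsum : om₁ + om₂ * t = Φ / (φ₁ + φ₃) := by
    rw [hom₁, hom₂]
    field_simp
    rw [hA, hΦ, hφ₁, hφ₂, hφ₃]
    ring
  have hψ : ψom = om₂ * ((α₁ t + α₃ t) * (φ₁ + φ₃)) / (A * Φ) := by
    rw [hψom, hom₂, div_mul_cancel₀ _ (mul_ne_zero hs hF)]
    congr 1
    rw [hφ₁, hφ₂, hφ₃]
    ring
  have hprod : mu om₁ om₂ u * mu ((α₁ t + α₃ t) / A) (-ψom) u = 1 := by
    rw [mu_mul_mu, ← ht, ← mu_one_zero u]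
    congr 1
    · rw [hom₁]
      field_simp
    · have h : om₁ * -ψom + om₂ * ((α₁ t + α₃ t) / A) + om₂ * -ψom * t
          = om₂ * ((α₁ t + α₃ t) / A) - ψom * (om₁ + om₂ * t) := by ring
      rw [h, hsum, hψ]
      field_simp
      ring
  refine ⟨IsUnit.of_mul_eq_one _ hprod, fun i j => ?_⟩
  rw [Matrix.inv_eq_right_inv hprod]
  simp only [mu, Matrix.of_apply]
  ring
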